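/- The commutative monoid M = ℤ⁺ ∪ {∞}, i.e. the additive monoid of natural numbers with an element ∞ adjoined satisfying ∞ + x = ∞ for all x ∈ M, is a graph monoid: there exists a countable row-finite directed graph E with M ≅ M(E). Equivalently, the commutative monoid with presentation ⟨p, a ∣ a = 2a, a = a + p⟩ is a graph monoid. -/

import Mathlib

namespace ArPardo

/-- A countable row-finite directed graph `E = (E⁰, E¹, s, r)`. -/
structure RowFiniteGraph : Type 1 where
  V : Type
  E : Type
  countableV : Countable V
  countableE : Countable E
  s : E → V
  r : E → V
  rowFinite : ∀ v : V, {e : E | s e = v}.Finite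

/-- The defining relations of the graph monoid, as a relation on the free
commutative monoid `V →₀ ℕ` on the vertices: for every vertex `v` emitting
at least one edge, `a_v = Σ_{e ∈ s⁻¹(v)} a_{r(e)}`. -/
def graphRel (G : RowFiniteGraph) (x y : G.V →₀ ℕ) : Prop :=
  ∃ v : G.V, (∃ e : G.E, G.s e = v) ∧ x = Finsupp.single v 1 ∧
    y = ∑ e ∈ (G.rowFinite v).toFinset, Finsupp.single (G.r e) 1

/-- The graph monoid `M(E)`: the quotient of the free commutative monoid on the
vertices by the congruence generated by the graph relations. -/
def graphMonoid (G : RowFiniteGraph) : Type :=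
  (addConGen (graphRel G)).Quotient

noncomputable instance (G : RowFiniteGraph) : AddCommMonoid (graphMonoid G) :=
  inferInstanceAs (AddCommMonoid (addConGen (graphRel G)).Quotient)

/-- The canonical generator `a_v` of the graph monoid. -/
noncomputable def vertexElem (G : RowFiniteGraph) (v : G.V) : graphMonoid G :=
  (addConGen (graphRel G)).mk' (Finsupp.single v 1)

/-- A commutative monoid is a graph monoid if it is isomorphic to `M(E)` for some
(countable) row-finite directed graph `E`. -/
def IsGraphMonoid (M : Type) [AddCommMonoid M] : Prop :=
  ∃ G : RowFiniteGraph, Nonempty (M ≃+ graphMonoid G)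

/-- The algebraic preorder on a commutative monoid: `x ≤ y` iff `y = x + z`. -/
def algLE {M : Type} [AddCommMonoid M] (x y : M) : Prop :=
  ∃ z : M, y = x + z

/-- A commutative monoid is conical if `x + y = 0` implies `x = y = 0`. -/
def IsConical (M : Type) [AddCommMonoid M] : Prop :=
  ∀ x y : M, x + y = 0 → x = 0 ∧ y = 0

/-- The Riesz refinement property. -/
def IsRefinement (M : Type) [AddCommMonoid M] : Prop :=
  ∀ a b c d : M, a + b = c + d →
    ∃ w x y z : M, a = w + x ∧ b = y + z ∧ c = w + y ∧ d = x + z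

/-- A prime element: not invertible, and `p ≤ a + b` implies `p ≤ a` or `p ≤ b`. -/
def IsPrimeElem {M : Type} [AddCommMonoid M] (p : M) : Prop :=
  (∀ q : M, p + q ≠ 0) ∧ ∀ a b : M, algLE p (a + b) → algLE p a ∨ algLE p b

/-- A free element: `n • p ≤ m • p` implies `n ≤ m`. -/
def IsFreeElem {M : Type} [AddCommMonoid M] (p : M) : Prop :=
  ∀ n m : ℕ, algLE (n • p) (m • p) → n ≤ m

/-- A regular element: `2x ≤ x`. -/
def IsRegularElem {M : Type} [AddCommMonoid M] (x : M) : Prop :=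
  algLE (x + x) x

/-- `q̄ < p̄` in the poset of (classes of) elements: `q ≤ p` and `p ≰ q`. -/
def classLT {M : Type} [AddCommMonoid M] (q p : M) : Prop :=
  algLE q p ∧ ¬ algLE p q

/-- `q` is a prime whose class lies in the lower cover of the class of the prime `p`:
`q̄ < p̄` and no prime class lies strictly between. -/
def InLowerCover {M : Type} [AddCommMonoid M] (p q : M) : Prop :=
  IsPrimeElem q ∧ classLT q p ∧
    ¬ ∃ t : M, IsPrimeElem t ∧ classLT q t ∧ classLT t p

/-- `Q` is a (finite) set of representatives of the classes in the lower cover of `p̄`: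
its elements are in the lower cover, pairwise inequivalent, and every prime in the
lower cover is equivalent to one of them. -/
def IsLowerCoverReps {M : Type} [AddCommMonoid M] (p : M) (Q : Finset M) : Prop :=
  (∀ q ∈ Q, InLowerCover p q) ∧
  (∀ q ∈ Q, ∀ q' ∈ Q, algLE q q' → algLE q' q → q = q') ∧
  (∀ t : M, InLowerCover p t → ∃ q ∈ Q, algLE q t ∧ algLE t q)

/-- The underlying set of the group `G'_p = {p + α : α ∈ M, p + α ≤ p}`. -/
def GpSet {M : Type} [AddCommMonoid M] (p : M) : Set M :=
  {y | ∃ α : M, y = p + α ∧ algLE y p}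

/-- `j : G' → M` realizes the abelian group `G'` as the group
`G'_p = {p + α : p + α ≤ p}` with identity `p` and operation
`(p + α) ∘ (p + β) = p + (α + β)`. -/
structure GpStructure (M : Type) [AddCommMonoid M] (p : M)
    (G' : Type) [AddCommGroup G'] (j : G' → M) : Prop where
  inj : Function.Injective j
  range_eq : Set.range j = GpSet p
  map_zero : j 0 = p
  map_add : ∀ (u v : G') (α β : M), j u = p + α → j v = p + β → j (u + v) = p + (α + β)

/-- The archimedean component of `s`: all `a` with `a ≤ n • s` and `s ≤ m • a` for
some positive integers `n, m`; it is a subsemigroup. -/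
def archComp {M : Type} [AddCommMonoid M] (s : M) : AddSubsemigroup M where
  carrier := {a : M | ∃ n m : ℕ, 0 < n ∧ 0 < m ∧ algLE a (n • s) ∧ algLE s (m • a)}
  add_mem' := by
    rintro a b ⟨n, m, hn, hm, ⟨z, hz⟩, ⟨w, hw⟩⟩ ⟨n', m', hn', hm', ⟨z', hz'⟩, ⟨w', hw'⟩⟩
    refine ⟨n + n', m, Nat.add_pos_left hn _, hm, ⟨z + z', ?_⟩, ⟨w + m • b, ?_⟩⟩
    · rw [add_nsmul, hz, hz']; abel
    · rw [nsmul_add, hw]; abel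

/-- `(Γ, ι)` is a Grothendieck group of the commutative semigroup `S`: every
semigroup homomorphism from `S` to an abelian group factors uniquely through `ι`. -/
def IsGrothendieck (S : Type) [Add S] (Γ : Type) [AddCommGroup Γ] (ι : AddHom S Γ) : Prop :=
  ∀ (A : Type) [AddCommGroup A], ∀ f : AddHom S A, ∃! g : Γ →+ A, ∀ x : S, g (ι x) = f x

/-- The almost-isomorphism condition at a free prime `p`, with `Q` a set of
representatives of the lower cover of `p̄`, and `s_p = Σ_{q ∈ Q} q`: for every
Grothendieck group `ι : M_{J_p} → Γ` of the archimedean component `M_{J_p}` of `s_p`,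
every realization `(G', j)` of the group `G'_p`, every incarnation
`φp : M_{J_p} → G'` of the map `x ↦ p + x`, the unique group homomorphism
`ψ = G(φ_p) : Γ → G'` with `ψ ∘ ι = φp` is surjective and its kernel is the cyclic
subgroup generated by `ι x` for some `x ∈ M_{J_p}`. -/
def AlmostIsoCondition (M : Type) [AddCommMonoid M] (p : M) (Q : Finset M) : Prop :=
  ∀ (Γ : Type) [AddCommGroup Γ],
    ∀ ι : AddHom (archComp (∑ q ∈ Q, (q : M))) Γ,
    IsGrothendieck (archComp (∑ q ∈ Q, (q : M))) Γ ι →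
    ∀ (G' : Type) [AddCommGroup G'], ∀ j : G' → M, GpStructure M p G' j →
    ∀ φp : AddHom (archComp (∑ q ∈ Q, (q : M))) G',
      (∀ a : archComp (∑ q ∈ Q, (q : M)), j (φp a) = p + (a : M)) →
    ∀ ψ : Γ →+ G', (∀ a, ψ (ι a) = φp a) →
      Function.Surjective ψ ∧
        ∃ x : archComp (∑ q ∈ Q, (q : M)), ψ.ker = AddSubgroup.zmultiples (ι x)

/-- An order-ideal of a commutative monoid. -/
def IsOrderIdeal {M : Type} [AddCommMonoid M] (S : Set M) : Prop :=
  (0 : M) ∈ S ∧ (∀ x y : M, x ∈ S → y ∈ S → x + y ∈ S) ∧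
    ∀ x y : M, algLE x y → y ∈ S → x ∈ S

/-- The order-ideal generated by a subset: the smallest order-ideal containing it. -/
def orderIdealGen {M : Type} [AddCommMonoid M] (X : Set M) : Set M :=
  ⋂₀ {S : Set M | IsOrderIdeal S ∧ X ⊆ S}

/-- The restriction graph `E_H` of a hereditary subset `H` of the vertices. -/
def restrictGraph (G : RowFiniteGraph) (H : Set G.V)
    (hher : ∀ e : G.E, G.s e ∈ H → G.r e ∈ H) : RowFiniteGraph where
  V := ↥H
  E := {e : G.E // G.s e ∈ H}
  countableV := by have := G.countableV; exact inferInstance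
  countableE := by have := G.countableE; exact inferInstance
  s := fun e => ⟨G.s e.1, e.2⟩
  r := fun e => ⟨G.r e.1, hher e.1 e.2⟩
  rowFinite := fun v => by
    have hsub : {e : {e : G.E // G.s e ∈ H} | (⟨G.s e.1, e.2⟩ : ↥H) = v}
        ⊆ Subtype.val ⁻¹' {e : G.E | G.s e = (v : G.V)} := by
      intro e he
      simpa [Subtype.ext_iff] using he
    exact Set.Finite.subset
      (Set.Finite.preimage (Subtype.val_injective.injOn) (G.rowFinite (v : G.V))) hsub

theorem algLE.trans {M : Type} [AddCommMonoid M] {x y z : M} (hxy : algLE x y)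
    (hyz : algLE y z) : algLE x z := by
  obtain ⟨u, rfl⟩ := hxy
  obtain ⟨w, rfl⟩ := hyz
  exact ⟨u + w, add_assoc x u w⟩

/-- If `x` absorbs `w`, then so does every element above `x`. -/
theorem algLE.absorb {M : Type} [AddCommMonoid M] {x y w : M} (hxy : algLE x y)
    (h : x + w = x) : y + w = y := by
  obtain ⟨z, rfl⟩ := hxy
  rw [add_right_comm, h]

/-- The row-finite graph in which the edges leaving `v` are listed, with multiplicity,
by their ranges in `F v`. -/
abbrev listGraph {V : Type} [Countable V] (F : V → List V) : RowFiniteGraph where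
  V := V
  E := Σ v, Fin (F v).length
  countableV := inferInstance
  countableE := inferInstance
  s := Sigma.fst
  r e := (F e.1).get e.2
  rowFinite v := (Set.finite_range (Sigma.mk v)).subset <| by
    rintro ⟨_, i⟩ rfl
    exact ⟨i, rfl⟩

theorem sum_listGraph {V : Type} [Countable V] (F : V → List V) {A : Type} [AddCommMonoid A]
    (f : V → A) (v : V) :
    ∑ e ∈ ((listGraph F).rowFinite v).toFinset, f ((listGraph F).r e) = ((F v).map f).sum := by
  have h : ((listGraph F).rowFinite v).toFinset =
      Finset.univ.map (Function.Embedding.sigmaMk (β := fun v => Fin (F v).length) v) := by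
    ext ⟨w, i⟩
    simp only [Set.Finite.mem_toFinset, Set.mem_ofPred_eq, Finset.mem_map, Finset.mem_univ,
      true_and]
    constructor
    · rintro rfl
      exact ⟨i, rfl⟩
    · rintro ⟨j, hj⟩
      exact (congrArg Sigma.fst hj).symm
  rw [h, Finset.sum_map]
  exact Fin.sum_univ_fun_getElem (F v) f

theorem vertexElem_listGraph {V : Type} [Countable V] (F : V → List V) (v : V) (hv : F v ≠ []) :
    vertexElem (listGraph F) v = ((F v).map (vertexElem (listGraph F))).sum := by
  rw [← sum_listGraph F]
  refine ((AddCon.eq _).2 (AddConGen.Rel.of _ _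
    ⟨v, ⟨⟨v, ⟨0, List.length_pos_iff.2 hv⟩⟩, rfl⟩, rfl, rfl⟩)).trans ?_
  exact map_sum (addConGen (graphRel (listGraph F))).mk' _ _

/-- An additive map out of a graph monoid is given by its values on the vertices. -/
theorem exists_graphMonoid_lift {V : Type} [Countable V] (F : V → List V) {A : Type}
    [AddCommMonoid A] (f : V → A) (hf : ∀ v, F v ≠ [] → f v = ((F v).map f).sum) :
    ∃ φ : graphMonoid (listGraph F) →+ A, ∀ v, φ (vertexElem (listGraph F) v) = f v := by
  let g : (V →₀ ℕ) →+ A := Finsupp.liftAddHom fun v => multiplesHom A (f v)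
  have hg (v : V) : g (Finsupp.single v 1) = f v := by simp [g]
  have hle : addConGen (graphRel (listGraph F)) ≤ AddCon.ker g := by
    refine AddCon.addConGen_le.2 ?_
    rintro _ _ ⟨v, ⟨e, rfl⟩, rfl, rfl⟩
    refine (hg _).trans ((hf _ ?_).trans ?_)
    · exact List.ne_nil_of_length_pos e.2.pos
    · refine Eq.trans ?_ (map_sum g _ _).symm
      rw [← sum_listGraph F]
      exact Finset.sum_congr rfl fun e _ => (hg _).symm
  exact ⟨(addConGen (graphRel (listGraph F))).lift g hle, hg⟩

theorem graphMonoid_induction (G : RowFiniteGraph) {P : graphMonoid G → Prop} (zero : P 0)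
    (add : ∀ x y, P x → P y → P (x + y)) (vertex : ∀ v, P (vertexElem G v))
    (x : graphMonoid G) : P x := by
  induction x using AddCon.induction_on with
  | H x =>
    induction x using Finsupp.induction_linear with
    | zero => exact zero
    | add x y hx hy => exact add _ _ hx hy
    | single v n =>
      induction n with
      | zero => rw [Finsupp.single_zero]; exact zero
      | succ n ih => rw [Finsupp.single_add]; exact add _ _ ih (vertex v)

/-- The edges of the graph realizing `ℕ∞`. The vertex `none` is a sink. The vertices
`(n, false)` and `(n, true)` emit the same edges, except that `(n, true)` has an additional
edge to `t n`. -/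
def enatEdges (t : ℕ → Option (ℕ × Bool)) : Option (ℕ × Bool) → List (Option (ℕ × Bool))
  | none => []
  | some (n, b) =>
    [some (n, b), some (0, false), some (0, true), some (n + 1, false), some (n + 1, true)] ++
      if b then [t n] else []

section Absorption

variable {M : Type} [AddCommMonoid M] {t : ℕ → Option (ℕ × Bool)} {f : Option (ℕ × Bool) → M}

theorem algLE_of_enatEdges (hf : ∀ v, enatEdges t v ≠ [] → f v = ((enatEdges t v).map f).sum)
    (i j : ℕ × Bool) : algLE (f (some j)) (f (some i)) := by
  have mem_le (i : ℕ × Bool) (w : Option (ℕ × Bool)) (hw : w ∈ enatEdges t (some i)) :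
      algLE (f w) (f (some i)) := by
    rw [hf (some i) (List.ne_nil_of_mem hw)]
    exact ⟨_, (((List.perm_cons_erase hw).map f).sum_eq).trans List.sum_cons⟩
  obtain ⟨m, c⟩ := j
  induction m generalizing c with
  | zero => exact mem_le _ _ (by cases c <;> simp [enatEdges])
  | succ m ih => exact (mem_le (m, c) _ (by cases c <;> simp [enatEdges])).trans (ih c)

theorem absorb_of_enatEdges (hf : ∀ v, enatEdges t v ≠ [] → f v = ((enatEdges t v).map f).sum)
    (i : ℕ × Bool) (n : ℕ) : f (some i) + f (t n) = f (some i) := by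
  let X := f (some (0, false)) + f (some (0, true)) + f (some (n + 1, false)) +
    f (some (n + 1, true))
  have hc : f (some (n, false)) + X = f (some (n, false)) := by
    conv_rhs => rw [hf (some (n, false)) (by simp [enatEdges])]
    simp [enatEdges, X, add_assoc]
  have hd : f (some (n, true)) + (X + f (t n)) = f (some (n, true)) := by
    conv_rhs => rw [hf (some (n, true)) (by simp [enatEdges])]
    simp [enatEdges, X, add_assoc]
  have h := (algLE_of_enatEdges hf i _).absorb hd
  rwa [← add_assoc, (algLE_of_enatEdges hf i _).absorb hc] at h

theorem eq_of_enatEdges (ht : Function.Surjective t)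
    (hf : ∀ v, enatEdges t v ≠ [] → f v = ((enatEdges t v).map f).sum)
    (i j : ℕ × Bool) : f (some i) = f (some j) := by
  obtain ⟨m, hm⟩ := ht (some i)
  obtain ⟨n, hn⟩ := ht (some j)
  rw [← absorb_of_enatEdges hf i n, hn, add_comm, ← hm, absorb_of_enatEdges hf j m]

end Absorption

/-- The monoid `ℤ⁺ ∪ {∞}` (the natural numbers with an absorbing
element `∞` adjoined, i.e. `ℕ∞`), equivalently the monoid `⟨p, a ∣ a = 2a, a = a + p⟩`,
is a graph monoid. -/
theorem enat_isGraphMonoid :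
    ∃ G : RowFiniteGraph, Nonempty ((ℕ∞) ≃+ graphMonoid G) := by
  obtain ⟨t, ht⟩ := exists_surjective_nat (Option (ℕ × Bool))
  let f : Option (ℕ × Bool) → ℕ∞ := fun v => v.elim 1 fun _ => ⊤
  obtain ⟨φ, hφ⟩ := exists_graphMonoid_lift (enatEdges t) f <| by
    rintro (_ | ⟨n, b⟩) hv
    · exact absurd rfl hv
    · simp [enatEdges, f]
  let a : Option (ℕ × Bool) → graphMonoid (listGraph (enatEdges t)) :=
    vertexElem (listGraph (enatEdges t))
  have ha : ∀ v, enatEdges t v ≠ [] → a v = ((enatEdges t v).map a).sum :=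
    vertexElem_listGraph _
  have absorb (v) : a (some (0, false)) + a v = a (some (0, false)) := by
    obtain ⟨n, rfl⟩ := ht v
    exact absorb_of_enatEdges ha _ n
  have absorb_nsmul (n : ℕ) : a (some (0, false)) + n • a none = a (some (0, false)) := by
    induction n with
    | zero => simp
    | succ n ih => rw [succ_nsmul, ← add_assoc, ih, absorb]
  have cases (x) : (∃ n : ℕ, x = n • a none) ∨ x = a (some (0, false)) := by
    induction x using graphMonoid_induction with
    | zero => exact .inl ⟨0, (zero_nsmul _).symm⟩
    | add x y hx hy =>
      rcases hx with ⟨m, rfl⟩ | rfl <;> rcases hy with ⟨n, rfl⟩ | rfl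
      · exact .inl ⟨m + n, (add_nsmul _ _ _).symm⟩
      · exact .inr ((add_comm _ _).trans (absorb_nsmul m))
      · exact .inr (absorb_nsmul n)
      · exact .inr (absorb _)
    | vertex v =>
      rcases v with _ | i
      · exact .inl ⟨1, (one_nsmul _).symm⟩
      · exact .inr (eq_of_enatEdges ht ha _ _)
  have φ_nsmul (n : ℕ) : φ (n • a none) = n := by
    rw [map_nsmul, show φ (a none) = 1 from hφ none, nsmul_one]
  have φ_top : φ (a (some (0, false))) = ⊤ := hφ _
  refine ⟨listGraph (enatEdges t), ⟨(AddEquiv.ofBijective φ ⟨fun x y hxy => ?_, fun n => ?_⟩).symm⟩⟩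
  · rcases cases x with ⟨m, rfl⟩ | rfl <;> rcases cases y with ⟨n, rfl⟩ | rfl
    · rw [φ_nsmul, φ_nsmul, Nat.cast_inj] at hxy
      rw [hxy]
    · rw [φ_nsmul, φ_top] at hxy
      exact absurd hxy (ENat.natCast_ne_top m)
    · rw [φ_nsmul, φ_top] at hxy
      exact absurd hxy.symm (ENat.natCast_ne_top n)
    · rfl
  · induction n using ENat.recTopCoe with
    | top => exact ⟨_, φ_top⟩
    | coe n => exact ⟨_, φ_nsmul n⟩

end ArPardo
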